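/- arXiv:1402.6209 — 2 statements merged into one kernel-verified Lean document; each statement's English description precedes it below -/
import Mathlib

section
/- Solenoidal injectivity for 1-tensors (vector fields) on the torus: let f = (f_1, ..., f_n) be a smooth vector field on 𝕋^n (n ≥ 2) such that ∫₀¹ Σ_i f_i(x + tv) v^i dt = 0 for every x ∈ 𝕋^n and every nonzero v ∈ ℤ^n. Then there is a smooth function h : 𝕋^n → ℂ with f = ∇h (i.e., f_i = ∂_i h for all i). -/
open MeasureTheory Real

/-- The character `UnitAddTorus.mFourier k` is constant along a direction
orthogonal to `k`. -/
theorem mFourier_add_coe_smul_of_sum_mul_eq_zero {d : Type*} [Fintype d] (k v : d → ℤ)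
    (hkv : ∑ i, k i * v i = 0) (s : ℝ) (z : UnitAddTorus d) :
    UnitAddTorus.mFourier k (z + fun i => ((s * v i : ℝ) : UnitAddCircle)) =
      UnitAddTorus.mFourier k z := by
  have h1 : ∏ i, fourier (k i) ((s * v i : ℝ) : UnitAddCircle) = 1 := by
    simp only [fourier_coe_apply]
    rw [← Complex.exp_sum]
    have h : (∑ i, (k i : ℂ) * (v i : ℂ)) = 0 := by exact_mod_cast hkv
    have : ∑ i, 2 * (π : ℂ) * Complex.I * (k i) * ((s * v i : ℝ) : ℂ) / ((1 : ℝ) : ℂ) =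
        2 * π * Complex.I * s * ∑ i, (k i : ℂ) * (v i : ℂ) := by
      rw [Finset.mul_sum]
      refine Finset.sum_congr rfl fun i _ => ?_
      push_cast
      ring
    rw [this, h, mul_zero, Complex.exp_zero]
  simp only [UnitAddTorus.mFourier, ContinuousMap.coe_mk, Pi.add_apply, fourier_apply, smul_add,
    AddCircle.toCircle_add, Circle.coe_mul, Finset.prod_mul_distrib]
  simp only [fourier_apply] at h1
  rw [h1, mul_one]

/-- A continuous function on the torus whose integrals over closed geodesics in some direction
orthogonal to `k` vanish has vanishing `k`-th Fourier coefficient. -/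
theorem mFourierCoeff_eq_zero_of_integral_geodesic_eq_zero {d : Type*} [Fintype d]
    (g : C(UnitAddTorus d, ℂ)) (k v : d → ℤ) (hkv : ∑ i, k i * v i = 0)
    (hg : ∀ z : UnitAddTorus d,
      ∫ s in (0 : ℝ)..1, g (z + fun i => ((s * v i : ℝ) : UnitAddCircle)) = 0) :
    UnitAddTorus.mFourierCoeff g k = 0 := by
  let μ : Measure (UnitAddTorus d) := Measure.pi fun _ => AddCircle.haarAddCircle
  let F : UnitAddTorus d → ℂ := fun z => UnitAddTorus.mFourier (-k) z * g z
  let τ : ℝ → UnitAddTorus d := fun s i => ((s * v i : ℝ) : UnitAddCircle)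
  have hτ : Continuous τ := continuous_pi fun i =>
    (AddCircle.continuous_mk' 1).comp (continuous_id.mul continuous_const)
  have hF : Continuous F := by fun_prop
  have hinv : ∀ s : ℝ, ∫ z, F (z + τ s) ∂μ = ∫ z, F z ∂μ := fun s =>
    integral_add_right_eq_self F (τ s)
  have hswap : ∫ s in (0 : ℝ)..1, ∫ z, F (z + τ s) ∂μ =
      ∫ z, (∫ s in (0 : ℝ)..1, F (z + τ s)) ∂μ := by
    refine intervalIntegral_integral_swap ?_
    have hc : Continuous (Function.uncurry fun (s : ℝ) z => F (z + τ s)) := by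
      unfold Function.uncurry
      fun_prop
    obtain ⟨C, hC⟩ := isCompact_univ.exists_bound_of_continuousOn hF.continuousOn
    rw [Set.uIoc_of_le zero_le_one]
    exact Integrable.of_bound hc.aestronglyMeasurable C
      (Filter.Eventually.of_forall fun p => hC _ (Set.mem_univ _))
  have hzero : ∀ z, ∫ s in (0 : ℝ)..1, F (z + τ s) = 0 := fun z => by
    have : ∀ s, F (z + τ s) = UnitAddTorus.mFourier (-k) z * g (z + τ s) := fun s => by
      have := mFourier_add_coe_smul_of_sum_mul_eq_zero (-k) v (by simpa using hkv) s z
      simp only [F, τ, this]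
    simp_rw [this]
    rw [intervalIntegral.integral_const_mul, hg z, mul_zero]
  simp_rw [hinv, hzero] at hswap
  have : ∫ z, F z ∂μ = 0 := by simpa using hswap
  exact this

/-- Injectivity of the X-ray transform: a continuous periodic function that, for each frequency,
integrates to zero over the closed geodesics in some orthogonal direction, vanishes. -/
theorem eq_zero_of_forall_exists_integral_geodesic_eq_zero {d : Type*} [Fintype d]
    (G : (d → ℝ) → ℂ) (hG : Continuous G)
    (hper : ∀ (x : d → ℝ) (m : d → ℤ), G (x + fun j => (m j : ℝ)) = G x)
    (h0 : ∀ k : d → ℤ, ∃ v : d → ℤ, ∑ i, k i * v i = 0 ∧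
      ∀ x : d → ℝ, ∫ s in (0 : ℝ)..1, G (x + s • fun j => (v j : ℝ)) = 0) (x : d → ℝ) :
    G x = 0 := by
  have hpi : IsOpenQuotientMap (Pi.map fun _ => ((↑) : ℝ → UnitAddCircle) :
      (d → ℝ) → UnitAddTorus d) :=
    IsOpenQuotientMap.piMap fun _ => QuotientAddGroup.isOpenQuotientMap_mk
  let p : C(d → ℝ, UnitAddTorus d) := ⟨_, hpi.continuous⟩
  have hp : IsOpenQuotientMap p := hpi
  have hfac : ∀ a b, p a = p b → G a = G b := by
    intro a b hab
    have h : ∀ i, ∃ m : ℤ, b i + m = a i := fun i => by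
      have h : ((a i - b i : ℝ) : UnitAddCircle) = 0 := by
        rw [AddCircle.coe_sub]
        exact sub_eq_zero.mpr (congrFun hab i)
      obtain ⟨m, hm⟩ := (AddCircle.coe_eq_zero_iff 1).mp h
      exact ⟨m, by rw [zsmul_one] at hm; rw [hm]; ring⟩
    choose m hm using h
    rw [← hper b m]
    congr 1
    ext i
    exact (hm i).symm
  let g : C(UnitAddTorus d, ℂ) := hp.isQuotientMap.lift ⟨G, hG⟩ fun a b => hfac a b
  have hgp : ∀ a, g (p a) = G a := fun a => by
    have := hp.isQuotientMap.lift_comp ⟨G, hG⟩ fun a b => hfac a b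
    exact DFunLike.congr_fun this a
  have hcoeff : ∀ k, UnitAddTorus.mFourierCoeff g k = 0 := by
    intro k
    obtain ⟨v, hkv, hv⟩ := h0 k
    refine mFourierCoeff_eq_zero_of_integral_geodesic_eq_zero g k v hkv fun z => ?_
    obtain ⟨a, rfl⟩ := hp.surjective z
    rw [← hv a]
    refine intervalIntegral.integral_congr fun s _ => ?_
    rw [← hgp]
    rfl
  have hsum := UnitAddTorus.hasSum_mFourier_series_apply_of_summable (f := g)
    (by rw [funext hcoeff]; exact summable_zero) (p x)
  simp only [hcoeff, zero_smul] at hsum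
  rw [← hgp]
  exact hsum.unique hasSum_zero

/-- Differentiation under the integral sign along a segment. -/
theorem integral_fderiv_apply_eq_zero {E F : Type*} [NormedAddCommGroup E] [NormedSpace ℝ E]
    [NormedAddCommGroup F] [NormedSpace ℝ F] {φ : E → F} (hφ : ContDiff ℝ 1 φ) (v : E)
    (h0 : ∀ x, ∫ t in (0 : ℝ)..1, φ (x + t • v) = 0) (x y : E) :
    ∫ t in (0 : ℝ)..1, fderiv ℝ φ (x + t • v) y = 0 := by
  have hd : Continuous (fderiv ℝ φ) := hφ.continuous_fderiv one_ne_zero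
  have hc := hφ.continuous
  obtain ⟨C, hC⟩ := ((isCompact_Icc (a := (-1 : ℝ)) (b := 1)).prod
    (isCompact_Icc (a := (0 : ℝ)) (b := 1))).exists_bound_of_continuousOn
    (f := fun q : ℝ × ℝ => fderiv ℝ φ (x + q.1 • y + q.2 • v) y) (by fun_prop)
  have key := (intervalIntegral.hasDerivAt_integral_of_dominated_loc_of_deriv_le
    (μ := volume) (a := 0) (b := 1) (x₀ := (0 : ℝ)) (s := Set.Icc (-1) 1) (bound := fun _ => C)
    (F := fun s t => φ (x + s • y + t • v)) (F' := fun s t => fderiv ℝ φ (x + s • y + t • v) y)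
    (Icc_mem_nhds (by norm_num) (by norm_num))
    (Filter.Eventually.of_forall fun s => Continuous.aestronglyMeasurable (by fun_prop))
    (Continuous.intervalIntegrable (by fun_prop) _ _)
    (Continuous.aestronglyMeasurable (by fun_prop))
    (Filter.Eventually.of_forall fun t ht s hs => hC (s, t)
      ⟨hs, by rw [Set.uIoc_of_le zero_le_one] at ht; exact Set.Ioc_subset_Icc_self ht⟩)
    intervalIntegrable_const
    (Filter.Eventually.of_forall fun t _ s _ => by
      have h1 : HasDerivAt (fun s : ℝ => x + s • y + t • v) y s := by
        simpa using (((hasDerivAt_id s).smul_const y).const_add x).add_const (t • v)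
      exact ((hφ.differentiable one_ne_zero _).hasFDerivAt).comp_hasDerivAt s h1)).2
  simp only [h0, zero_smul, add_zero] at key
  exact key.unique (hasDerivAt_const _ _)

/-- The fundamental theorem of calculus along a segment. -/
theorem integral_fderiv_apply_segment {E F : Type*} [NormedAddCommGroup E] [NormedSpace ℝ E]
    [NormedAddCommGroup F] [NormedSpace ℝ F] [CompleteSpace F] {φ : E → F} (hφ : ContDiff ℝ 1 φ)
    (x v : E) :
    ∫ t in (0 : ℝ)..1, fderiv ℝ φ (x + t • v) v = φ (x + v) - φ x := by
  have hd : Continuous (fderiv ℝ φ) := hφ.continuous_fderiv one_ne_zero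
  rw [intervalIntegral.integral_eq_sub_of_hasDerivAt (f := fun t : ℝ => φ (x + t • v))
    (fun t _ => ?_) (Continuous.intervalIntegrable (by fun_prop) _ _)]
  · simp
  · have h1 : HasDerivAt (fun t : ℝ => x + t • v) v t := by
      simpa using ((hasDerivAt_id t).smul_const v).const_add x
    exact ((hφ.differentiable one_ne_zero _).hasFDerivAt).comp_hasDerivAt t h1

/-- The X-ray transform of the exterior derivative of a periodic `1`-form with vanishing X-ray
transform vanishes. -/
theorem integral_fderiv_sub_fderiv_flip_eq_zero {d : Type*} [Fintype d]
    {ω : (d → ℝ) → (d → ℝ) →L[ℝ] ℂ} (hω : ContDiff ℝ 1 ω) {v : d → ℤ}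
    (hper : ∀ x, ω (x + fun j => (v j : ℝ)) = ω x)
    (h0 : ∀ x, ∫ t in (0 : ℝ)..1, ω (x + t • fun j => (v j : ℝ)) (fun j => (v j : ℝ)) = 0)
    (x y : d → ℝ) :
    ∫ t in (0 : ℝ)..1, (fderiv ℝ ω (x + t • fun j => (v j : ℝ)) y (fun j => (v j : ℝ)) -
      fderiv ℝ ω (x + t • fun j => (v j : ℝ)) (fun j => (v j : ℝ)) y) = 0 := by
  have hd : Continuous (fderiv ℝ ω) := hω.continuous_fderiv one_ne_zero
  have happ : ∀ u x z, fderiv ℝ (fun x => ω x u) x z = fderiv ℝ ω x z u := fun u x z => by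
    rw [((hω.differentiable one_ne_zero x).hasFDerivAt.clm_apply (hasFDerivAt_const u x)).fderiv]
    simp
  have hC : ∀ u, ContDiff ℝ 1 fun x => ω x u := fun u => hω.clm_apply contDiff_const
  have h1 := integral_fderiv_apply_eq_zero (hC fun j => (v j : ℝ)) _ h0 x y
  have h2 := integral_fderiv_apply_segment (hC y) x fun j => (v j : ℝ)
  simp only [happ, hper, sub_self] at h1 h2
  rw [intervalIntegral.integral_sub (Continuous.intervalIntegrable (by fun_prop) _ _)
    (Continuous.intervalIntegrable (by fun_prop) _ _), h1, h2, sub_zero]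

/-- A periodic `1`-form with vanishing X-ray transform is closed. -/
theorem fderiv_symmetric_of_integral_geodesic_eq_zero {d : Type*} [Fintype d]
    {ω : (d → ℝ) → (d → ℝ) →L[ℝ] ℂ} (hω : ContDiff ℝ 1 ω)
    (hper : ∀ (x : d → ℝ) (m : d → ℤ), ω (x + fun j => (m j : ℝ)) = ω x)
    (h0 : ∀ (x : d → ℝ) (v : d → ℤ), v ≠ 0 →
      ∫ t in (0 : ℝ)..1, ω (x + t • fun j => (v j : ℝ)) (fun j => (v j : ℝ)) = 0)
    (x y z : d → ℝ) : fderiv ℝ ω x y z = fderiv ℝ ω x z y := by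
  classical
  have hd : Continuous (fderiv ℝ ω) := hω.continuous_fderiv one_ne_zero
  have hdper : ∀ (x : d → ℝ) (m : d → ℤ), fderiv ℝ ω (x + fun j => (m j : ℝ)) = fderiv ℝ ω x :=
    fun x m => by
      rw [← fderiv_comp_add_right]
      simp only [hper]
  have hbasis : ∀ i j : d, fderiv ℝ ω x (Pi.single i 1) (Pi.single j 1) =
      fderiv ℝ ω x (Pi.single j 1) (Pi.single i 1) := by
    intro i j
    rcases eq_or_ne i j with rfl | hij
    · rfl
    rw [← sub_eq_zero]
    refine eq_zero_of_forall_exists_integral_geodesic_eq_zero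
      (fun x => fderiv ℝ ω x (Pi.single i 1) (Pi.single j 1) -
        fderiv ℝ ω x (Pi.single j 1) (Pi.single i 1)) (by fun_prop)
      (fun x m => by simp only [hdper]) (fun k => ?_) x
    obtain ⟨a, b, hab, hk⟩ : ∃ a b : ℤ, (a ≠ 0 ∨ b ≠ 0) ∧ k i * a + k j * b = 0 := by
      by_cases hki : k i = 0
      · exact ⟨1, 0, Or.inl one_ne_zero, by simp [hki]⟩
      · exact ⟨k j, -k i, Or.inr (neg_ne_zero.mpr hki), by ring⟩
    let v : d → ℤ := Pi.single i a + Pi.single j b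
    have hvi : v i = a := by simp [v, hij]
    have hvj : v j = b := by simp [v, hij.symm]
    have hv : v ≠ 0 := fun h => by
      rcases hab with ha | hb
      · exact ha (by rw [← hvi, h]; rfl)
      · exact hb (by rw [← hvj, h]; rfl)
    have hvr : (fun l => (v l : ℝ)) =
        (a : ℝ) • (Pi.single i 1 : d → ℝ) + (b : ℝ) • (Pi.single j 1 : d → ℝ) := by
      ext l
      simp [v, Pi.single_apply]
    refine ⟨v, ?_, fun x => ?_⟩
    · simp [v, mul_add, Finset.sum_add_distrib, Pi.single_apply, hk]
    · have H := fun y => integral_fderiv_sub_fderiv_flip_eq_zero hω (hper · v) (h0 · v hv) x y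
      rcases hab with ha | hb
      · have := H (Pi.single j 1)
        rw [← mul_right_inj' (neg_ne_zero.mpr (Int.cast_ne_zero (α := ℂ) |>.mpr ha)), mul_zero,
          ← this, ← intervalIntegral.integral_const_mul]
        refine intervalIntegral.integral_congr fun t _ => ?_
        simp only [hvr, map_add, map_smul, add_apply,
          smul_apply, Complex.real_smul]
        push_cast
        ring
      · have := H (Pi.single i 1)
        rw [← mul_right_inj' (Int.cast_ne_zero (α := ℂ) |>.mpr hb), mul_zero,
          ← this, ← intervalIntegral.integral_const_mul]
        refine intervalIntegral.integral_congr fun t _ => ?_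
        simp only [hvr, map_add, map_smul, add_apply,
          smul_apply, Complex.real_smul]
        push_cast
        ring
  rw [pi_eq_sum_univ' y, pi_eq_sum_univ' z]
  simp only [map_sum, map_smul, sum_apply, smul_apply,
    Finset.smul_sum]
  rw [Finset.sum_comm]
  refine Finset.sum_congr rfl fun i _ => Finset.sum_congr rfl fun j _ => ?_
  rw [hbasis, smul_comm]

/-- Solenoidal injectivity for 1-tensors: a smooth vector field on `𝕋ⁿ` (`n ≥ 2`) with
vanishing X-ray transform is a gradient. -/
theorem vector_field_sinjective (n : ℕ) (hn : 2 ≤ n)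
    (f : Fin n → ((Fin n → ℝ) → ℂ))
    (hf : ∀ i, ContDiff ℝ (⊤ : ℕ∞) (f i))
    (hper : ∀ i, ∀ (x : Fin n → ℝ) (m : Fin n → ℤ), f i (x + fun j => (m j : ℝ)) = f i x)
    (h0 : ∀ (x : Fin n → ℝ) (v : Fin n → ℤ), v ≠ 0 →
      (∫ t in (0:ℝ)..1, ∑ i, f i (x + t • fun j => (v j : ℝ)) * (v i : ℂ)) = 0) :
    ∃ h : (Fin n → ℝ) → ℂ, ContDiff ℝ (⊤ : ℕ∞) h ∧
      (∀ (x : Fin n → ℝ) (m : Fin n → ℤ), h (x + fun j => (m j : ℝ)) = h x) ∧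
      ∀ i x, f i x = fderiv ℝ h x (Pi.single i 1) := by
  classical
  let ω : (Fin n → ℝ) → (Fin n → ℝ) →L[ℝ] ℂ := fun x =>
    ∑ i, (ContinuousLinearMap.proj i : (Fin n → ℝ) →L[ℝ] ℝ).smulRight (f i x)
  have hωa : ∀ x y, ω x y = ∑ i, f i x * (y i : ℂ) := fun x y => by
    simp [ω, mul_comm]
  have hω : ContDiff ℝ (⊤ : ℕ∞) ω := ContDiff.sum fun i _ => contDiff_const.smulRight (hf i)
  have hω1 : ContDiff ℝ 1 ω := hω.of_le (by exact_mod_cast le_top)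
  have hωper : ∀ (x : Fin n → ℝ) (m : Fin n → ℤ), ω (x + fun j => (m j : ℝ)) = ω x :=
    fun x m => by simp only [ω, hper]
  have hω0 : ∀ (x : Fin n → ℝ) (v : Fin n → ℤ), v ≠ 0 →
      ∫ t in (0 : ℝ)..1, ω (x + t • fun j => (v j : ℝ)) (fun j => (v j : ℝ)) = 0 := by
    intro x v hv
    rw [← h0 x v hv]
    simp only [hωa, Complex.ofReal_intCast]
  obtain ⟨h, hh⟩ := convex_univ.exists_forall_hasFDerivAt_of_fderiv_symmetric isOpen_univ
    (hω1.differentiable one_ne_zero).differentiableOn fun x _ =>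
      fderiv_symmetric_of_integral_geodesic_eq_zero hω1 hωper hω0 x
  have hfd : fderiv ℝ h = ω := funext fun x => (hh x trivial).fderiv
  have hsmooth : ContDiff ℝ (⊤ : ℕ∞) h := contDiff_infty_iff_fderiv.mpr
    ⟨fun x => (hh x trivial).differentiableAt, hfd ▸ hω⟩
  refine ⟨h, hsmooth, fun x m => ?_, fun i x => ?_⟩
  · rcases eq_or_ne m 0 with rfl | hm
    · congr 1
      ext j
      simp
    · have := integral_fderiv_apply_segment (hsmooth.of_le (by exact_mod_cast le_top)) x
        fun j => (m j : ℝ)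
      rw [hfd, hω0 x m hm] at this
      exact (sub_eq_zero.mp this.symm)
  · rw [hfd, hωa]
    simp [Pi.single_apply, apply_ite]
end

section
/- Solenoidal injectivity for symmetric 2-tensors on the torus: let f_{ij} (1 ≤ i,j ≤ n) be smooth functions on 𝕋^n with f_{ij} = f_{ji}, such that ∫₀¹ Σ_{i,j} f_{ij}(x + tv) v^i v^j dt = 0 for every x ∈ 𝕋^n and every nonzero v ∈ ℤ^n (n ≥ 2). Then there are smooth functions h_1, ..., h_n on 𝕋^n such that f_{ij} = (∂_i h_j + ∂_j h_i)/2 for all i, j. -/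
open MeasureTheory Real

noncomputable section TorusFourier

open UnitAddTorus

/-- The Haar probability measure on `ℝ / ℤ`, as in Mathlib's multivariate Fourier series. -/
local instance : MeasureSpace UnitAddCircle := ⟨AddCircle.haarAddCircle⟩

local instance : Measure.IsAddHaarMeasure (volume : Measure UnitAddCircle) :=
  inferInstanceAs (Measure.IsAddHaarMeasure AddCircle.haarAddCircle)

local instance : IsProbabilityMeasure (volume : Measure UnitAddCircle) :=
  inferInstanceAs (IsProbabilityMeasure AddCircle.haarAddCircle)

variable {d : Type*}

/-- Invariance of a function on `ℝᵈ` under translations by `ℤᵈ`. -/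
def LatticePeriodic {α : Type*} (f : (d → ℝ) → α) : Prop :=
  ∀ (x : d → ℝ) (m : d → ℤ), f (x + fun l => (m l : ℝ)) = f x

/-- The quotient map `ℝᵈ → ℝᵈ / ℤᵈ`. -/
def toTorus (x : d → ℝ) : UnitAddTorus d := fun i => (x i : UnitAddCircle)

/-- The coordinates in `[0, 1)` of a point of the torus. -/
def torusRep (t : UnitAddTorus d) : d → ℝ := fun i => (AddCircle.equivIco 1 0 (t i) : ℝ)

/-- The function on the torus induced by a function on `ℝᵈ`. -/
def descend {α : Type*} (f : (d → ℝ) → α) (t : UnitAddTorus d) : α := f (torusRep t)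

lemma toTorus_torusRep (t : UnitAddTorus d) : toTorus (torusRep t) = t :=
  funext fun _ => AddCircle.coe_equivIco

lemma toTorus_add (x y : d → ℝ) : toTorus (x + y) = toTorus x + toTorus y := rfl

lemma LatticePeriodic.eq_of_toTorus_eq {α : Type*} {f : (d → ℝ) → α} (hf : LatticePeriodic f)
    {x y : d → ℝ} (h : toTorus x = toTorus y) : f x = f y := by
  have h' : ∀ i, ∃ m : ℤ, x i = y i + m := fun i => by
    have hi : ((x i - y i : ℝ) : UnitAddCircle) = 0 := by
      rw [AddCircle.coe_sub]
      exact sub_eq_zero.2 (congrFun h i)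
    obtain ⟨m, hm⟩ := (AddCircle.coe_eq_zero_iff (1 : ℝ)).1 hi
    exact ⟨m, by simp at hm; linarith⟩
  choose m hm using h'
  rw [← hf y m]
  exact congrArg f (funext hm)

lemma LatticePeriodic.descend_toTorus {α : Type*} {f : (d → ℝ) → α} (hf : LatticePeriodic f)
    (x : d → ℝ) : descend f (toTorus x) = f x :=
  hf.eq_of_toTorus_eq (toTorus_torusRep _)

lemma isOpenQuotientMap_toTorus : IsOpenQuotientMap (toTorus (d := d)) :=
  IsOpenQuotientMap.piMap fun _ => QuotientAddGroup.isOpenQuotientMap_mk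

lemma continuous_toTorus : Continuous (toTorus (d := d)) :=
  isOpenQuotientMap_toTorus.continuous

lemma LatticePeriodic.continuous_descend {f : (d → ℝ) → ℂ} (hf : LatticePeriodic f)
    (hc : Continuous f) : Continuous (descend f) := by
  rw [isOpenQuotientMap_toTorus.isQuotientMap.continuous_iff]
  exact hc.congr fun x => (hf.descend_toTorus x).symm

lemma LatticePeriodic.descend_translate {f : (d → ℝ) → ℂ} (hf : LatticePeriodic f)
    (s : d → ℝ) (t : UnitAddTorus d) :
    descend (fun x => f (x + s)) t = descend f (t + toTorus s) := by
  conv_rhs => rw [← toTorus_torusRep t, ← toTorus_add, hf.descend_toTorus]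
  rfl

lemma LatticePeriodic.translate {f : (d → ℝ) → ℂ} (hf : LatticePeriodic f) (s : d → ℝ) :
    LatticePeriodic fun x => f (x + s) := fun x m => by
  simpa only [add_right_comm] using hf (x + s) m

lemma LatticePeriodic.mul {f g : (d → ℝ) → ℂ} (hf : LatticePeriodic f) (hg : LatticePeriodic g) :
    LatticePeriodic fun x => f x * g x := fun x m => by simp only [hf x m, hg x m]

variable [Fintype d]

lemma LatticePeriodic.fderiv {f : (d → ℝ) → ℂ} (hf : LatticePeriodic f) :
    LatticePeriodic (fderiv ℝ f) := fun x m => by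
  rw [← fderiv_comp_add_right]
  exact congrArg (fun g => _root_.fderiv ℝ g x) (funext fun y => hf y m)

lemma integral_descend_translate {f : (d → ℝ) → ℂ} (hf : LatticePeriodic f) (s : d → ℝ) :
    ∫ t, descend (fun x => f (x + s)) t = ∫ t, descend f t := by
  simp_rw [hf.descend_translate]
  exact integral_add_right_eq_self _ _

lemma integrable_of_continuous {g : UnitAddTorus d → ℂ} (hg : Continuous g) : Integrable g :=
  hg.integrable_of_hasCompactSupport (HasCompactSupport.of_compactSpace g)

lemma integral_descend_fderiv {f : (d → ℝ) → ℂ} (hf : LatticePeriodic f) (hc : ContDiff ℝ 1 f)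
    (v : d → ℝ) : ∫ t, descend (fun x => fderiv ℝ f x v) t = 0 := by
  have hp : LatticePeriodic fun x => fderiv ℝ f x v := fun x m => by simp only [hf.fderiv x m]
  have hpc : Continuous fun x => fderiv ℝ f x v :=
    (hc.continuous_fderiv one_ne_zero).clm_apply continuous_const
  have hDc := hp.continuous_descend hpc
  obtain ⟨C, hC⟩ : ∃ C, ∀ t, ‖descend (fun x => fderiv ℝ f x v) t‖ ≤ C :=
    ⟨_, (⟨_, hDc⟩ : C(UnitAddTorus d, ℂ)).norm_coe_le_norm⟩
  have hderiv : ∀ (t : UnitAddTorus d) (s : ℝ),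
      HasDerivAt (fun s : ℝ => descend (fun x => f (x + s • v)) t)
        (descend (fun x => fderiv ℝ f (x + s • v) v) t) s := fun t s => by
    have h1 : HasDerivAt (fun s : ℝ => torusRep t + s • v) v s := by
      simpa using ((hasDerivAt_id s).smul_const v).const_add (torusRep t)
    exact ((hc.differentiable one_ne_zero _).hasFDerivAt).comp_hasDerivAt s h1
  have hcont : ∀ s : ℝ, Continuous (descend fun x => f (x + s • v)) := fun s =>
    (hf.translate _).continuous_descend (hc.continuous.comp (continuous_id.add continuous_const))
  have hcont' : ∀ s : ℝ, Continuous (descend fun x => fderiv ℝ f (x + s • v) v) := fun s =>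
    (hp.translate _).continuous_descend (hpc.comp (continuous_id.add continuous_const))
  have hbound : ∀ (t : UnitAddTorus d) (s : ℝ),
      ‖descend (fun x => fderiv ℝ f (x + s • v) v) t‖ ≤ C := fun t s => by
    rw [hp.descend_translate (s • v)]
    exact hC _
  have key := hasDerivAt_integral_of_dominated_loc_of_deriv_le
    (μ := (volume : Measure (UnitAddTorus d)))
    (F := fun (s : ℝ) t => descend (fun x => f (x + s • v)) t)
    (F' := fun (s : ℝ) t => descend (fun x => fderiv ℝ f (x + s • v) v) t)
    (x₀ := 0) (s := Set.univ) (bound := fun _ => C) Filter.univ_mem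
    (.of_forall fun s => (hcont s).aestronglyMeasurable) (integrable_of_continuous (hcont 0))
    (hcont' 0).aestronglyMeasurable (.of_forall fun t s _ => hbound t s) (integrable_const _)
    (.of_forall fun t s _ => hderiv t s)
  have h2 := key.2
  simp only [integral_descend_translate hf, zero_smul, add_zero] at h2
  exact h2.unique (hasDerivAt_const _ _)

lemma integral_descend_segment {f : (d → ℝ) → ℂ} (hf : LatticePeriodic f) (hc : Continuous f)
    (v : d → ℝ) :
    ∫ t, descend (fun x => ∫ s in (0 : ℝ)..1, f (x + s • v)) t = ∫ t, descend f t := by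
  have hD := hf.continuous_descend hc
  let G : C(UnitAddTorus d, ℂ) := ⟨_, hD⟩
  have : IsFiniteMeasure ((volume : Measure ℝ).restrict (Set.uIoc 0 1)) := ⟨by simp⟩
  have hf_int : Integrable (Function.uncurry fun (s : ℝ) t => descend f (t + toTorus (s • v)))
      ((volume.restrict (Set.uIoc 0 1)).prod volume) := by
    refine Integrable.of_bound (C := ‖G‖) (Continuous.aestronglyMeasurable ?_)
      (.of_forall fun p => G.norm_coe_le_norm _)
    exact hD.comp (continuous_snd.add
      (continuous_toTorus.comp (continuous_fst.smul continuous_const)))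
  have h1 := intervalIntegral_integral_swap hf_int
  have h2 : ∀ t, descend (fun x => ∫ s in (0 : ℝ)..1, f (x + s • v)) t
      = ∫ s in (0 : ℝ)..1, descend f (t + toTorus (s • v)) := fun t => by
    simp_rw [← hf.descend_translate]
    rfl
  simp_rw [h2, ← h1, integral_add_right_eq_self]
  simp

/-- The character `x ↦ exp (2πi k·x)` of `ℝᵈ`. -/
def latticeChar (k : d → ℤ) (x : d → ℝ) : ℂ :=
  Complex.exp (2 * π * Complex.I * ∑ i, (k i : ℂ) * (x i : ℂ))

lemma mFourier_toTorus (k : d → ℤ) (x : d → ℝ) : mFourier k (toTorus x) = latticeChar k x := by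
  simp only [mFourier, toTorus, ContinuousMap.coe_mk, fourier_coe_apply, latticeChar,
    Finset.mul_sum, Complex.exp_sum]
  refine Finset.prod_congr rfl fun i _ => ?_
  congr 1
  push_cast
  ring

lemma latticePeriodic_latticeChar (k : d → ℤ) : LatticePeriodic (latticeChar k) := fun x m => by
  have h : toTorus (x + fun l => (m l : ℝ)) = toTorus x := by
    ext i
    simp [toTorus]
  rw [← mFourier_toTorus, ← mFourier_toTorus, h]

lemma norm_latticeChar (k : d → ℤ) (x : d → ℝ) : ‖latticeChar k x‖ = 1 := by
  rw [latticeChar, show 2 * π * Complex.I * ∑ i, (k i : ℂ) * (x i : ℂ)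
    = ((2 * π * ∑ i, (k i : ℝ) * x i : ℝ) : ℂ) * Complex.I by push_cast; ring]
  exact Complex.norm_exp_ofReal_mul_I _

lemma latticeChar_add (k : d → ℤ) (x y : d → ℝ) :
    latticeChar k (x + y) = latticeChar k x * latticeChar k y := by
  simp only [latticeChar, ← Complex.exp_add, Pi.add_apply, Complex.ofReal_add, mul_add,
    Finset.sum_add_distrib]

/-- The complex-valued linear form `v ↦ 2πi k·v` on `ℝᵈ`. -/
def frequencyForm (k : d → ℤ) : (d → ℝ) →L[ℝ] ℂ :=
  ∑ i, (2 * π * Complex.I * (k i : ℂ)) •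
    (Complex.ofRealCLM.comp (ContinuousLinearMap.proj i : (d → ℝ) →L[ℝ] ℝ))

lemma frequencyForm_apply (k : d → ℤ) (v : d → ℝ) :
    frequencyForm k v = 2 * π * Complex.I * ∑ i, (k i : ℂ) * (v i : ℂ) := by
  simp [frequencyForm, Finset.mul_sum, mul_assoc]

lemma hasFDerivAt_latticeChar (k : d → ℤ) (x : d → ℝ) :
    HasFDerivAt (latticeChar k) (latticeChar k x • frequencyForm k) x := by
  have h := (frequencyForm k).hasFDerivAt (x := x) |>.cexp
  simp only [frequencyForm_apply] at h
  exact h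

lemma contDiff_latticeChar (k : d → ℤ) {N : WithTop ℕ∞} : ContDiff ℝ N (latticeChar k) := by
  have h := (frequencyForm k).contDiff (n := N) |>.cexp
  simp only [frequencyForm_apply] at h
  exact h

/-- The Fourier coefficients of a periodic function on `ℝᵈ`. -/
def latticeCoeff (f : (d → ℝ) → ℂ) (k : d → ℤ) : ℂ := mFourierCoeff (descend f) k

lemma latticeCoeff_eq (f : (d → ℝ) → ℂ) (k : d → ℤ) :
    latticeCoeff f k = ∫ t, descend (fun x => latticeChar (-k) x * f x) t := by
  refine integral_congr_ae (.of_forall fun t => ?_)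
  change mFourier (-k) t * _ = _
  rw [← toTorus_torusRep t, mFourier_toTorus, toTorus_torusRep]
  rfl

lemma norm_latticeCoeff_le {f : (d → ℝ) → ℂ} (hf : LatticePeriodic f) (hc : Continuous f) :
    ∃ C, ∀ k, ‖latticeCoeff f k‖ ≤ C := by
  let G : C(UnitAddTorus d, ℂ) := ⟨_, hf.continuous_descend hc⟩
  refine ⟨‖G‖, fun k => ?_⟩
  rw [latticeCoeff_eq]
  refine (norm_integral_le_of_norm_le_const (C := ‖G‖) (.of_forall fun t => ?_)).trans (by simp)
  simp only [descend, norm_mul, norm_latticeChar, one_mul]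
  exact G.norm_coe_le_norm t

lemma latticeCoeff_fderiv {f : (d → ℝ) → ℂ} (hf : LatticePeriodic f) (hc : ContDiff ℝ 1 f)
    (v : d → ℝ) (k : d → ℤ) :
    latticeCoeff (fun x => fderiv ℝ f x v) k = frequencyForm k v * latticeCoeff f k := by
  have h := integral_descend_fderiv ((latticePeriodic_latticeChar (-k)).mul hf)
    ((contDiff_latticeChar (-k)).mul hc) v
  have hd : ∀ x, fderiv ℝ (fun x => latticeChar (-k) x * f x) x v
      = latticeChar (-k) x * fderiv ℝ f x v
        - frequencyForm k v * (latticeChar (-k) x * f x) := fun x => by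
    have hx := (hasFDerivAt_latticeChar (-k) x).mul
      (hc.differentiable one_ne_zero x).hasFDerivAt
    rw [show (fun x => latticeChar (-k) x * f x) = latticeChar (-k) * f from rfl, hx.fderiv]
    simp [frequencyForm_apply]
    ring
  have hp : LatticePeriodic fun x => fderiv ℝ f x v := fun x m => by simp only [hf.fderiv x m]
  have hpc : Continuous fun x => fderiv ℝ f x v :=
    (hc.continuous_fderiv one_ne_zero).clm_apply continuous_const
  have hch := (contDiff_latticeChar (-k) (N := 0)).continuous
  simp_rw [hd] at h
  rw [latticeCoeff_eq, latticeCoeff_eq, ← integral_const_mul, ← sub_eq_zero, ← integral_sub]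
  · exact h
  · exact integrable_of_continuous
      (((latticePeriodic_latticeChar (-k)).mul hp).continuous_descend (hch.mul hpc))
  · exact (integrable_of_continuous (((latticePeriodic_latticeChar (-k)).mul hf).continuous_descend
      (hch.mul hc.continuous))).const_mul _

/-- Families of coefficients on `ℤᵈ` decaying faster than any power of the frequency. -/
def RapidDecay (a : (d → ℤ) → ℂ) : Prop := ∀ N : ℕ, Summable fun k => ‖k‖ ^ N * ‖a k‖

lemma RapidDecay.of_norm_le {a b : (d → ℤ) → ℂ} (ha : RapidDecay a) (C : ℝ) (M : ℕ)
    (h : ∀ k, ‖b k‖ ≤ C * ‖k‖ ^ M * ‖a k‖) : RapidDecay b := fun N =>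
  .of_nonneg_of_le (fun k => by positivity)
    (fun k => (mul_le_mul_of_nonneg_left (h k) (by positivity)).trans_eq
      (show _ = C * (‖k‖ ^ (N + M) * ‖a k‖) by ring))
    ((ha (N + M)).mul_left C)

lemma RapidDecay.sub {a b : (d → ℤ) → ℂ} (ha : RapidDecay a) (hb : RapidDecay b) :
    RapidDecay fun k => a k - b k := fun N =>
  .of_nonneg_of_le (fun k => by positivity)
    (fun k => (mul_le_mul_of_nonneg_left (norm_sub_le _ _) (by positivity)).trans_eq (mul_add _ _ _))
    ((ha N).add (hb N))

lemma RapidDecay.sum {ι : Type*} (s : Finset ι) {a : ι → (d → ℤ) → ℂ}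
    (ha : ∀ i ∈ s, RapidDecay (a i)) : RapidDecay fun k => ∑ i ∈ s, a i k := fun N =>
  .of_nonneg_of_le (fun k => by positivity)
    (fun k => (mul_le_mul_of_nonneg_left (norm_sum_le _ _) (by positivity)).trans_eq
      (Finset.mul_sum _ _ _))
    (summable_sum fun i hi => ha i hi N)

lemma RapidDecay.summable_norm {a : (d → ℤ) → ℂ} (ha : RapidDecay a) :
    Summable fun k => ‖a k‖ := by
  simpa using ha 0

lemma abs_coord_le_norm (k : d → ℤ) (i : d) : |(k i : ℝ)| ≤ ‖k‖ := by
  simpa [Int.norm_eq_abs] using norm_le_pi_norm k i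

lemma norm_frequencyForm_le (k : d → ℤ) :
    ‖frequencyForm k‖ ≤ 2 * π * Fintype.card d * ‖k‖ := by
  refine ContinuousLinearMap.opNorm_le_bound _ (by positivity) fun v => ?_
  have h : ‖∑ i, (k i : ℂ) * (v i : ℂ)‖ ≤ ∑ _i : d, ‖k‖ * ‖v‖ :=
    norm_sum_le_of_le _ fun i _ => by
      rw [norm_mul, Complex.norm_real, Complex.norm_intCast]
      exact mul_le_mul (abs_coord_le_norm k i) (norm_le_pi_norm v i) (by positivity) (by positivity)
  rw [frequencyForm_apply, norm_mul]
  calc _ ≤ ‖(2 * π * Complex.I : ℂ)‖ * ∑ _i : d, ‖k‖ * ‖v‖ := by gcongr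
    _ = _ := by simp [abs_of_pos pi_pos]; ring

lemma summable_lattice_norm_inv_pow {N : ℕ} (hN : Fintype.card d < N) :
    Summable fun k : d → ℤ => ‖k‖⁻¹ ^ N := by
  classical
  let L := Submodule.span ℤ (Set.range (Pi.basisFun ℝ d))
  have hL : Module.finrank ℤ L < N := by
    rw [ZLattice.rank ℝ L]
    simpa using hN
  let φ : (d → ℤ) → L := fun k => ⟨fun i => (k i : ℝ), by
    rw [Module.Basis.mem_span_iff_repr_mem]
    intro i
    exact ⟨k i, by simp⟩⟩
  have hφ : Function.Injective φ := fun k l h => by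
    ext i
    have hi : (k i : ℝ) = l i := congrFun (congrArg Subtype.val h) i
    exact_mod_cast hi
  refine ((ZLattice.summable_norm_pow_inv L N hL).comp_injective hφ).congr fun k => ?_
  have h : ‖φ k‖ = ‖k‖ := by
    change ‖fun i => (k i : ℝ)‖ = ‖k‖
    simp only [Pi.norm_def, ← Int.norm_cast_real, nnnorm]
  rw [Function.comp_apply, h]

lemma frequencyForm_single [DecidableEq d] (k : d → ℤ) (i : d) :
    frequencyForm k (Pi.single i 1) = 2 * π * Complex.I * k i := by
  rw [frequencyForm_apply, Finset.sum_eq_single i] <;> simp +contextual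

lemma norm_pow_mul_latticeCoeff_le (N : ℕ) {f : (d → ℝ) → ℂ} (hf : LatticePeriodic f)
    (hc : ContDiff ℝ (⊤ : ℕ∞) f) : ∃ C, ∀ k, ‖k‖ ^ N * ‖latticeCoeff f k‖ ≤ C := by
  classical
  induction N generalizing f with
  | zero => simpa using norm_latticeCoeff_le hf hc.continuous
  | succ N ih =>
    have hd : ∀ l, ∃ C, ∀ k, ‖k‖ ^ N *
        ‖latticeCoeff (fun x => fderiv ℝ f x (Pi.single l 1)) k‖ ≤ C := fun l =>
      ih (fun x m => by simp only [hf.fderiv x m])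
        ((contDiff_infty_iff_fderiv.1 hc).2.clm_apply contDiff_const)
    choose C hC using hd
    refine ⟨∑ l, C l, fun k => ?_⟩
    have hk : ‖k‖ ≤ ∑ l, |(k l : ℝ)| :=
      (pi_norm_le_iff_of_nonneg (Finset.sum_nonneg fun _ _ => abs_nonneg _)).2 fun l => by
        rw [Int.norm_eq_abs]
        exact Finset.single_le_sum (f := fun l => |(k l : ℝ)|) (fun _ _ => abs_nonneg _)
          (Finset.mem_univ l)
    calc ‖k‖ ^ (N + 1) * ‖latticeCoeff f k‖
        = ‖k‖ * (‖k‖ ^ N * ‖latticeCoeff f k‖) := by ring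
      _ ≤ (∑ l, |(k l : ℝ)|) * (‖k‖ ^ N * ‖latticeCoeff f k‖) := by gcongr
      _ = ∑ l, |(k l : ℝ)| * (‖k‖ ^ N * ‖latticeCoeff f k‖) := Finset.sum_mul _ _ _
      _ ≤ ∑ l, C l := Finset.sum_le_sum fun l _ => by
        refine le_trans ?_ (hC l k)
        rw [latticeCoeff_fderiv hf (hc.of_le (by exact_mod_cast le_top)), frequencyForm_single]
        simp only [norm_mul, Complex.norm_real, Complex.norm_intCast, Complex.norm_I,
          Complex.norm_ofNat, mul_one, norm_eq_abs, abs_of_pos pi_pos]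
        have h2 : 1 ≤ 2 * π := by linarith [pi_gt_three]
        have h3 : 0 ≤ |(k l : ℝ)| * (‖k‖ ^ N * ‖latticeCoeff f k‖) := by positivity
        nlinarith

lemma rapidDecay_latticeCoeff {f : (d → ℝ) → ℂ} (hf : LatticePeriodic f)
    (hc : ContDiff ℝ (⊤ : ℕ∞) f) : RapidDecay (latticeCoeff f) := fun N => by
  obtain ⟨C, hC⟩ := norm_pow_mul_latticeCoeff_le (N + (Fintype.card d + 1)) hf hc
  refine .of_norm_bounded_eventually
    ((summable_lattice_norm_inv_pow (Nat.lt_succ_self _)).mul_left C) ?_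
  refine (Set.finite_singleton (0 : d → ℤ)).subset fun k hk => ?_
  by_contra h0
  have hpos : 0 < ‖k‖ := norm_pos_iff.2 h0
  refine hk ?_
  change ‖‖k‖ ^ N * ‖latticeCoeff f k‖‖ ≤ C * ‖k‖⁻¹ ^ (Fintype.card d + 1)
  rw [Real.norm_of_nonneg (by positivity), inv_pow, ← div_eq_mul_inv, le_div_iff₀ (by positivity)]
  refine le_trans (le_of_eq ?_) (hC k)
  ring

/-- The sum of the Fourier series with coefficients `a`. -/
def latticeSeries (a : (d → ℤ) → ℂ) (x : d → ℝ) : ℂ := ∑' k, a k * latticeChar k x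

lemma RapidDecay.summable_series {a : (d → ℤ) → ℂ} (ha : RapidDecay a) (x : d → ℝ) :
    Summable fun k => a k * latticeChar k x :=
  .of_norm (by simpa [norm_latticeChar] using ha.summable_norm)

lemma latticePeriodic_latticeSeries (a : (d → ℤ) → ℂ) : LatticePeriodic (latticeSeries a) :=
  fun x m => tsum_congr fun k => by rw [latticePeriodic_latticeChar k x m]

lemma RapidDecay.frequencyForm_mul {a : (d → ℤ) → ℂ} (ha : RapidDecay a) (v : d → ℝ) :
    RapidDecay fun k => frequencyForm k v * a k :=
  ha.of_norm_le (2 * π * Fintype.card d * ‖v‖) 1 fun k => by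
    rw [norm_mul]
    refine mul_le_mul_of_nonneg_right ?_ (norm_nonneg _)
    refine ((frequencyForm k).le_of_opNorm_le (norm_frequencyForm_le k) v).trans_eq ?_
    ring

lemma RapidDecay.summable_norm_mul {a : (d → ℤ) → ℂ} (ha : RapidDecay a) :
    Summable fun k => 2 * π * Fintype.card d * (‖k‖ * ‖a k‖) :=
  Summable.mul_left _ (by simpa using ha 1)

lemma norm_smul_latticeChar_smul_frequencyForm_le (a : (d → ℤ) → ℂ) (k : d → ℤ) (x : d → ℝ) :
    ‖a k • latticeChar k x • frequencyForm k‖ ≤ 2 * π * Fintype.card d * (‖k‖ * ‖a k‖) := by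
  rw [norm_smul, norm_smul, norm_latticeChar, one_mul]
  refine (mul_le_mul_of_nonneg_left (norm_frequencyForm_le k) (norm_nonneg _)).trans_eq ?_
  ring

lemma RapidDecay.hasFDerivAt_latticeSeries {a : (d → ℤ) → ℂ} (ha : RapidDecay a) (x : d → ℝ) :
    HasFDerivAt (latticeSeries a) (∑' k, a k • latticeChar k x • frequencyForm k) x :=
  hasFDerivAt_tsum ha.summable_norm_mul
    (fun k x => (hasFDerivAt_latticeChar k x).const_mul (a k))
    (norm_smul_latticeChar_smul_frequencyForm_le a) (ha.summable_series 0) x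

lemma RapidDecay.fderiv_latticeSeries {a : (d → ℤ) → ℂ} (ha : RapidDecay a) (x v : d → ℝ) :
    fderiv ℝ (latticeSeries a) x v = latticeSeries (fun k => frequencyForm k v * a k) x := by
  rw [(ha.hasFDerivAt_latticeSeries x).fderiv]
  have hs : Summable fun k => a k • latticeChar k x • frequencyForm k :=
    .of_norm_bounded ha.summable_norm_mul fun k => norm_smul_latticeChar_smul_frequencyForm_le a k x
  refine ((ContinuousLinearMap.apply ℝ ℂ v).map_tsum hs).trans (tsum_congr fun k => ?_)
  simp
  ring

lemma RapidDecay.contDiff_latticeSeries {a : (d → ℤ) → ℂ} (ha : RapidDecay a) :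
    ContDiff ℝ (⊤ : ℕ∞) (latticeSeries a) := by
  refine contDiff_infty.2 fun N => ?_
  induction N generalizing a with
  | zero =>
    exact contDiff_zero.2 (Differentiable.continuous (𝕜 := ℝ) fun x =>
      (ha.hasFDerivAt_latticeSeries x).differentiableAt)
  | succ N ih =>
    push_cast
    refine contDiff_succ_iff_fderiv_apply.2
      ⟨fun x => (ha.hasFDerivAt_latticeSeries x).differentiableAt, by simp, fun v => ?_⟩
    simp_rw [ha.fderiv_latticeSeries]
    exact ih (ha.frequencyForm_mul v)

lemma latticeSeries_latticeCoeff {f : (d → ℝ) → ℂ} (hf : LatticePeriodic f)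
    (hc : ContDiff ℝ (⊤ : ℕ∞) f) (x : d → ℝ) : latticeSeries (latticeCoeff f) x = f x := by
  let G : C(UnitAddTorus d, ℂ) := ⟨_, hf.continuous_descend hc.continuous⟩
  have h := hasSum_mFourier_series_apply_of_summable (f := G)
    (Summable.of_norm (rapidDecay_latticeCoeff hf hc).summable_norm) (toTorus x)
  simp only [mFourier_toTorus] at h
  exact h.tsum_eq.trans (hf.descend_toTorus x)

lemma latticeCoeff_eq_zero_of_xray {f : (d → ℝ) → ℂ} (hf : LatticePeriodic f)
    (hc : Continuous f) (v k : d → ℤ) (hkv : ∑ i, k i * v i = 0)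
    (h0 : ∀ x : d → ℝ, ∫ t in (0 : ℝ)..1, f (x + t • fun l => (v l : ℝ)) = 0) :
    latticeCoeff f k = 0 := by
  have hchar : ∀ (x : d → ℝ) (t : ℝ),
      latticeChar (-k) (x + t • fun l => (v l : ℝ)) = latticeChar (-k) x := fun x t => by
    have hkv' : ∑ i, (k i : ℂ) * (v i : ℂ) = 0 := by exact_mod_cast hkv
    have hsum : ∑ i, (k i : ℂ) * ((t : ℂ) * v i) = 0 := by
      simp_rw [mul_left_comm _ (t : ℂ)]
      rw [← Finset.mul_sum, hkv', mul_zero]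
    rw [latticeChar_add]
    simp [latticeChar, hsum]
  rw [latticeCoeff_eq, ← integral_descend_segment ((latticePeriodic_latticeChar (-k)).mul hf)
    ((contDiff_latticeChar (-k) (N := 0)).continuous.mul hc) fun l => (v l : ℝ)]
  simp [hchar, h0, descend]

lemma latticeCoeff_sum_mul {ι : Type*} (s : Finset ι) {f : ι → (d → ℝ) → ℂ}
    (hf : ∀ i, LatticePeriodic (f i)) (hc : ∀ i, Continuous (f i)) (c : ι → ℂ) (k : d → ℤ) :
    latticeCoeff (fun x => ∑ i ∈ s, f i x * c i) k = ∑ i ∈ s, latticeCoeff (f i) k * c i := by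
  simp_rw [latticeCoeff_eq, ← integral_mul_const]
  rw [← integral_finsetSum]
  · simp [descend, Finset.mul_sum, mul_assoc]
  · exact fun i _ => (integrable_of_continuous
      (((latticePeriodic_latticeChar (-k)).mul (hf i)).continuous_descend
        ((contDiff_latticeChar (-k) (N := 0)).continuous.mul (hc i)))).mul_const _

end TorusFourier

/-- The vector potential at frequency `k` of a quadratic form `A` vanishing on `k^⊥`. -/
noncomputable def symbolPotential {d : Type*} [Fintype d] (A : d → d → ℂ) (k : d → ℤ) (i : d) : ℂ :=
  (∑ l, 2 * (∑ p, (k p : ℂ) ^ 2)⁻¹ * k l * A i l) -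
    ∑ l, ∑ m, (∑ p, (k p : ℂ) ^ 2)⁻¹ ^ 2 * k i * k l * k m * A l m

lemma eq_symm_symbolPotential {d : Type*} [Fintype d] (A : d → d → ℂ)
    (hA : ∀ i j, A i j = A j i) (k : d → ℤ)
    (h : ∀ v : d → ℤ, ∑ i, k i * v i = 0 → ∑ i, ∑ j, A i j * v i * v j = 0) (i j : d) :
    A i j = (k i * symbolPotential A k j + k j * symbolPotential A k i) / 2 := by
  classical
  obtain ⟨B, hB⟩ : ∃ B : (d → ℂ) →ₗ[ℂ] (d → ℂ) →ₗ[ℂ] ℂ,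
      ∀ u w : d → ℂ, B u w = ∑ i, ∑ j, A i j * u i * w j := by
    refine ⟨Matrix.toLinearMap₂' ℂ (Matrix.of A), fun u w => ?_⟩
    simp only [Matrix.toLinearMap₂'_apply, Matrix.of_apply, smul_eq_mul]
    exact Finset.sum_congr rfl fun i _ => Finset.sum_congr rfl fun j _ => by ring
  have hBsymm : ∀ u w, B u w = B w u := fun u w => by
    rw [hB, hB, Finset.sum_comm]
    exact Finset.sum_congr rfl fun i _ => Finset.sum_congr rfl fun j _ => by rw [hA]; ring
  have hpol : ∀ u w : d → ℤ, ∑ i, k i * u i = 0 → ∑ i, k i * w i = 0 →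
      B (fun l => (u l : ℂ)) (fun l => (w l : ℂ)) = 0 := fun u w hu hw => by
    have h1 := h u hu
    have h2 := h w hw
    have h3 := h (u + w) (by simp [mul_add, Finset.sum_add_distrib, hu, hw])
    rw [← hB (fun l => (u l : ℂ)) (fun l => (u l : ℂ))] at h1
    rw [← hB (fun l => (w l : ℂ)) (fun l => (w l : ℂ))] at h2
    rw [← hB (fun l => ((u + w) l : ℂ)) (fun l => ((u + w) l : ℂ)),
      show (fun l => (((u + w) l : ℤ) : ℂ)) = (fun l => (u l : ℂ)) + fun l => (w l : ℂ) by
        ext; simp] at h3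
    simp only [map_add, LinearMap.add_apply, h1, h2, hBsymm (fun l => (w l : ℂ))] at h3
    linear_combination h3 / 2
  set κ : d → ℂ := fun l => (k l : ℂ) with hκ
  have hBe : ∀ i j, B (Pi.single i 1) (Pi.single j 1) = A i j := fun i j => by
    simp [hB, Pi.single_apply]
  have hBκ : ∀ i, B (Pi.single i 1) κ = ∑ l, k l * A i l := fun i => by
    simp [hB, hκ, Pi.single_apply, mul_comm]
  by_cases hk : k = 0
  · have := hpol (Pi.single i 1) (Pi.single j 1) (by simp [hk]) (by simp [hk])
    rw [show (fun l => ((Pi.single i 1 : d → ℤ) l : ℂ)) = Pi.single i 1 by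
        ext l; simp [Pi.single_apply],
      show (fun l => ((Pi.single j 1 : d → ℤ) l : ℂ)) = Pi.single j 1 by
        ext l; simp [Pi.single_apply], hBe] at this
    simp [hk, this]
  set q : ℤ := ∑ p, k p ^ 2 with hq
  have hq0 : (q : ℂ) ≠ 0 := by
    obtain ⟨p, hp⟩ := Function.ne_iff.1 hk
    have : 0 < q := Finset.sum_pos' (fun _ _ => sq_nonneg _)
      ⟨p, Finset.mem_univ _, sq_pos_of_ne_zero hp⟩
    exact_mod_cast this.ne'
  have hqc : ∑ p, (k p : ℂ) ^ 2 = q := by simp [hq]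
  let u : d → d → ℤ := fun i => q • Pi.single i 1 - k i • k
  have hu : ∀ i, ∑ l, k l * u i l = 0 := fun i => by
    simp only [u, Pi.sub_apply, Pi.smul_apply, smul_eq_mul, mul_sub, Finset.sum_sub_distrib,
      Pi.single_apply]
    simp [hq, mul_comm, mul_left_comm, ← Finset.mul_sum, ← sq]
  have huc : ∀ i, (fun l => (u i l : ℂ)) = (q : ℂ) • Pi.single i 1 - (k i : ℂ) • κ := fun i => by
    ext l
    simp [u, hκ, Pi.single_apply]
  have key := hpol (u i) (u j) (hu i) (hu j)
  have hw : ∀ i, symbolPotential A k i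
      = 2 * (q : ℂ)⁻¹ * B (Pi.single i 1) κ - (q : ℂ)⁻¹ ^ 2 * k i * B κ κ := fun i => by
    rw [hBκ, hB]
    simp only [symbolPotential, hqc, hκ, Finset.mul_sum]
    congr 1
    · exact Finset.sum_congr rfl fun l _ => by ring
    · exact Finset.sum_congr rfl fun l _ => Finset.sum_congr rfl fun m _ => by ring
  rw [huc, huc] at key
  simp only [map_sub, map_smul, LinearMap.sub_apply, LinearMap.smul_apply, smul_eq_mul, hBe,
    hBsymm κ (Pi.single j 1)] at key
  rw [hw, hw]
  field_simp
  linear_combination 2 * key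

lemma rapidDecay_symbolPotential {d : Type*} [Fintype d] {A : d → d → (d → ℤ) → ℂ}
    (hA : ∀ i j, RapidDecay (A i j)) (i : d) :
    RapidDecay fun k => symbolPotential (fun i j => A i j k) k i := by
  have hq : ∀ k : d → ℤ, ‖(∑ p, (k p : ℂ) ^ 2)⁻¹‖ ≤ 1 := fun k => by
    rw [show ∑ p, (k p : ℂ) ^ 2 = ((∑ p, k p ^ 2 : ℤ) : ℂ) by push_cast; rfl, norm_inv,
      Complex.norm_intCast]
    rcases eq_or_ne (∑ p, k p ^ 2) 0 with h | h
    · simp [h]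
    · exact inv_le_one_of_one_le₀ (by exact_mod_cast Int.one_le_abs h)
  have hk : ∀ (k : d → ℤ) (l : d), ‖(k l : ℂ)‖ ≤ ‖k‖ := fun k l => by
    rw [Complex.norm_intCast]
    exact abs_coord_le_norm k l
  refine .sub (.sum _ fun l _ => (hA i l).of_norm_le 2 1 fun k => ?_)
    (.sum _ fun l _ => .sum _ fun m _ => (hA l m).of_norm_le 1 3 fun k => ?_)
  · simp only [norm_mul, Complex.norm_ofNat, pow_one]
    calc _ ≤ 2 * 1 * ‖k‖ * ‖A i l k‖ := by gcongr <;> first | exact hq k | exact hk k _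
      _ = _ := by ring
  · simp only [norm_mul, norm_pow]
    calc _ ≤ 1 ^ 2 * ‖k‖ * ‖k‖ * ‖k‖ * ‖A l m k‖ := by gcongr <;> first | exact hq k | exact hk k _
      _ = _ := by ring

/-- Solenoidal injectivity for symmetric 2-tensors: a smooth symmetric 2-tensor field on
`𝕋ⁿ` (`n ≥ 2`) with vanishing X-ray transform is a symmetrized gradient of a 1-tensor. -/
theorem two_tensor_sinjective (n : ℕ) (hn : 2 ≤ n)
    (f : Fin n → Fin n → ((Fin n → ℝ) → ℂ))
    (hf : ∀ i j, ContDiff ℝ (⊤ : ℕ∞) (f i j))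
    (hsym : ∀ i j, f i j = f j i)
    (hper : ∀ i j, ∀ (x : Fin n → ℝ) (m : Fin n → ℤ),
      f i j (x + fun l => (m l : ℝ)) = f i j x)
    (h0 : ∀ (x : Fin n → ℝ) (v : Fin n → ℤ), v ≠ 0 →
      (∫ t in (0:ℝ)..1,
        ∑ i, ∑ j, f i j (x + t • fun l => (v l : ℝ)) * (v i : ℂ) * (v j : ℂ)) = 0) :
    ∃ h : Fin n → ((Fin n → ℝ) → ℂ),
      (∀ i, ContDiff ℝ (⊤ : ℕ∞) (h i)) ∧
      (∀ i, ∀ (x : Fin n → ℝ) (m : Fin n → ℤ), h i (x + fun l => (m l : ℝ)) = h i x) ∧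
      ∀ i j x, f i j x =
        (fderiv ℝ (h j) x (Pi.single i 1) + fderiv ℝ (h i) x (Pi.single j 1)) / 2 := by
  let A : Fin n → Fin n → (Fin n → ℤ) → ℂ := fun i j => latticeCoeff (f i j)
  have hp : ∀ i j, LatticePeriodic (f i j) := hper
  have hA : ∀ i j, RapidDecay (A i j) := fun i j => rapidDecay_latticeCoeff (hp i j) (hf i j)
  have hvanish : ∀ k v : Fin n → ℤ, ∑ i, k i * v i = 0 →
      ∑ i, ∑ j, A i j k * v i * v j = 0 := fun k v hkv => by
    rcases eq_or_ne v 0 with rfl | hv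
    · simp
    have hsum : ∀ x, ∑ i, ∑ j, f i j x * (v i : ℂ) * (v j : ℂ)
        = ∑ p : Fin n × Fin n, f p.1 p.2 x * ((v p.1 : ℂ) * v p.2) := fun x => by
      simp only [Fintype.sum_prod_type, mul_assoc]
    have h0' := fun x => h0 x v hv
    simp_rw [hsum] at h0'
    have hcoeff := latticeCoeff_eq_zero_of_xray
      (f := fun x => ∑ p : Fin n × Fin n, f p.1 p.2 x * ((v p.1 : ℂ) * v p.2))
      (fun x m => by simp only [hper])
      (continuous_finsetSum _ fun p _ => (hf p.1 p.2).continuous.mul continuous_const)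
      v k hkv h0'
    rw [latticeCoeff_sum_mul _ (f := fun p : Fin n × Fin n => f p.1 p.2) (fun p => hp p.1 p.2)
      fun p => (hf p.1 p.2).continuous] at hcoeff
    simpa only [Fintype.sum_prod_type, mul_assoc] using hcoeff
  let b : Fin n → (Fin n → ℤ) → ℂ := fun i k =>
    (2 * π * Complex.I)⁻¹ * symbolPotential (fun i j => A i j k) k i
  have hb : ∀ i, RapidDecay (b i) := fun i =>
    (rapidDecay_symbolPotential hA i).of_norm_le ‖(2 * π * Complex.I : ℂ)⁻¹‖ 0 fun k => by
      simp [b]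
  refine ⟨fun i => latticeSeries (b i), fun i => (hb i).contDiff_latticeSeries,
    fun i => latticePeriodic_latticeSeries (b i), fun i j x => ?_⟩
  rw [(hb j).fderiv_latticeSeries, (hb i).fderiv_latticeSeries,
    ← latticeSeries_latticeCoeff (hp i j) (hf i j) x, latticeSeries, latticeSeries, latticeSeries,
    ← ((hb j).frequencyForm_mul _).summable_series x |>.tsum_add
      (((hb i).frequencyForm_mul _).summable_series x), ← tsum_div_const]
  refine tsum_congr fun k => ?_
  have hk := eq_symm_symbolPotential (fun i j => A i j k)
    (fun i j => by simp only [A, hsym i j]) k (hvanish k) i j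
  have hpi : (2 * π * Complex.I : ℂ) ≠ 0 := Complex.two_pi_I_ne_zero
  simp only [frequencyForm_single, b]
  change A i j k * _ = _
  rw [hk]
  field_simp
end
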